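/- arXiv:1707.07109 — 2 statements merged into one kernel-verified Lean document; each statement's English description precedes it below -/
import Mathlib

section
/- Let f₀, g₀ > 0, C_p, C_q > 0, p, q > 0 with pq > 1, and let (f, g) be non-negative C¹ solutions on the maximal interval [0, T) of f' = (p+1) C_p g^p, g' = (q+1) C_q f^q with f(0) = f₀, g(0) = g₀. If C_q f₀^{q+1} ≥ C_p g₀^{p+1}, then the maximal existence time satisfies T ≤ (2^{pq/(q+1)}/(pq-1)) · C_p^{-1/(p+1)} C_q^{-p/(p+1)} f₀^{-(pq-1)/(p+1)}. -/
open Real Set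

theorem monotoneOn_Ico_of_hasDerivAt_nonneg {a b : ℝ} {u u' : ℝ → ℝ}
    (hu : ∀ t ∈ Ico a b, HasDerivAt u (u' t) t) (hu' : ∀ t ∈ Ico a b, 0 ≤ u' t) :
    MonotoneOn u (Ico a b) :=
  monotoneOn_of_hasDerivWithinAt_nonneg (convex_Ico a b)
    (fun t ht => (hu t ht).continuousAt.continuousWithinAt)
    (fun t ht => (hu t (interior_subset ht)).hasDerivWithinAt)
    (fun t ht => hu' t (interior_subset ht))

/-- A positive solution of `h' ≥ A h ^ (1 + γ)` on `[0, T)` with `A, γ > 0` can only exist up to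
time `h(0) ^ (-γ) / (γ A)`. -/
theorem le_of_rpow_le_deriv {T A γ : ℝ} (hT : 0 < T) (hA : 0 < A) (hγ : 0 < γ) {h h' : ℝ → ℝ}
    (hpos : ∀ t ∈ Ico 0 T, 0 < h t) (hh : ∀ t ∈ Ico 0 T, HasDerivAt h (h' t) t)
    (hle : ∀ t ∈ Ico 0 T, A * h t ^ (1 + γ) ≤ h' t) :
    T ≤ h 0 ^ (-γ) / (γ * A) := by
  have hmono : MonotoneOn (fun t => -(h t ^ (-γ)) - γ * A * t) (Ico 0 T) := by
    refine monotoneOn_Ico_of_hasDerivAt_nonneg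
      (fun t ht => (((hh t ht).rpow_const (Or.inl (hpos t ht).ne')).neg).sub
        ((hasDerivAt_id t).const_mul (γ * A))) fun t ht => ?_
    have hinv : h t ^ (1 + γ) * h t ^ (-γ - 1) = 1 := by
      rw [← rpow_add (hpos t ht), show 1 + γ + (-γ - 1) = 0 by ring, rpow_zero]
    have hmul := mul_le_mul_of_nonneg_right (hle t ht) (rpow_nonneg (hpos t ht).le (-γ - 1))
    rw [mul_assoc, hinv] at hmul
    nlinarith [mul_le_mul_of_nonneg_left hmul hγ.le]
  have h0 : (0 : ℝ) ∈ Ico 0 T := ⟨le_rfl, hT⟩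
  refine le_of_forall_lt_imp_le_of_dense fun t htT => ?_
  rcases lt_or_ge t 0 with ht | ht
  · exact ht.le.trans (div_nonneg (rpow_nonneg (hpos 0 h0).le _) (by positivity))
  · have key := hmono h0 ⟨ht, htT⟩ ht
    have := rpow_nonneg (hpos t ⟨ht, htT⟩).le (-γ)
    rw [le_div_iff₀ (by positivity)]
    simp only at key
    linarith

theorem add_rpow_le_two_rpow_mul {x y r : ℝ} (hx : 0 ≤ x) (hy : 0 ≤ y) (hr : 1 ≤ r) :
    (x + y) ^ r ≤ 2 ^ (r - 1) * (x ^ r + y ^ r) := by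
  lift x to NNReal using hx
  lift y to NNReal using hy
  exact_mod_cast NNReal.rpow_add_le_mul_rpow_add_rpow x y hr

theorem stmt_5 (f₀ g₀ Cp Cq T p q : ℝ)
    (hf₀ : 0 < f₀) (hg₀ : 0 < g₀) (hCp : 0 < Cp) (hCq : 0 < Cq) (hT : 0 < T)
    (hp : 0 < p) (hq : 0 < q) (hpq : 1 < p * q)
    (f g : ℝ → ℝ)
    (hfnn : ∀ t ∈ Set.Ico (0 : ℝ) T, 0 ≤ f t) (hgnn : ∀ t ∈ Set.Ico (0 : ℝ) T, 0 ≤ g t)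
    (hf' : ∀ t ∈ Set.Ico (0 : ℝ) T, HasDerivAt f ((p + 1) * Cp * g t ^ p) t)
    (hg' : ∀ t ∈ Set.Ico (0 : ℝ) T, HasDerivAt g ((q + 1) * Cq * f t ^ q) t)
    (hf0 : f 0 = f₀) (hg0 : g 0 = g₀)
    (hmax : ¬ ∃ (T' : ℝ) (F G : ℝ → ℝ), T < T' ∧
      (∀ t ∈ Set.Ico (0 : ℝ) T, F t = f t ∧ G t = g t) ∧
      (∀ t ∈ Set.Ico (0 : ℝ) T', 0 ≤ F t ∧ 0 ≤ G t) ∧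
      (∀ t ∈ Set.Ico (0 : ℝ) T',
        HasDerivAt F ((p + 1) * Cp * G t ^ p) t ∧ HasDerivAt G ((q + 1) * Cq * F t ^ q) t))
    (hinit : Cp * g₀ ^ (p + 1) ≤ Cq * f₀ ^ (q + 1)) :
    T ≤ 2 ^ (p * q / (q + 1)) / (p * q - 1) * Cp ^ (-((1 : ℝ) / (p + 1))) *
      Cq ^ (-(p / (p + 1))) * f₀ ^ (-((p * q - 1) / (p + 1))) := by
  have h0 : (0 : ℝ) ∈ Ico 0 T := ⟨le_rfl, hT⟩
  have hgpos : ∀ t ∈ Ico 0 T, 0 < g t := fun t ht => by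
    have := monotoneOn_Ico_of_hasDerivAt_nonneg hg'
      (fun s hs => mul_nonneg (by positivity) (rpow_nonneg (hfnn s hs) q)) h0 ht ht.1
    linarith
  have hEderiv : ∀ t ∈ Ico 0 T,
      HasDerivAt (fun s => Cq * f s ^ (q + 1) - Cp * g s ^ (p + 1)) 0 t := fun t ht => by
    have := (((hf' t ht).rpow_const (p := q + 1) (Or.inr (by linarith))).const_mul Cq).sub
      (((hg' t ht).rpow_const (p := p + 1) (Or.inr (by linarith))).const_mul Cp)
    refine this.congr_deriv ?_
    rw [add_sub_cancel_right, add_sub_cancel_right]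
    ring
  obtain ⟨K, hK⟩ : ∃ K, K = Cq * f₀ ^ (q + 1) - Cp * g₀ ^ (p + 1) := ⟨_, rfl⟩
  have hK0 : 0 ≤ K := by linarith
  have hE : ∀ t ∈ Ico 0 T, Cq * f t ^ (q + 1) = Cp * g t ^ (p + 1) + K := fun t ht => by
    have h1 := monotoneOn_Ico_of_hasDerivAt_nonneg hEderiv (fun _ _ => le_rfl) h0 ht ht.1
    have h2 := monotoneOn_Ico_of_hasDerivAt_nonneg (fun s hs => (hEderiv s hs).neg)
      (fun _ _ => by simp) h0 ht ht.1
    simp only [Pi.neg_apply, hf0, hg0] at h1 h2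
    linarith
  obtain ⟨c, hc⟩ : ∃ c, c = Cp ^ ((1 : ℝ) / (p + 1)) := ⟨_, rfl⟩
  have hc0 : 0 < c := hc ▸ rpow_pos_of_pos hCp _
  have hcp : c ^ (p + 1) = Cp := by
    rw [hc, ← rpow_mul hCp.le, one_div_mul_cancel (by positivity), rpow_one]
  obtain ⟨k, hk⟩ : ∃ k, k = K ^ ((1 : ℝ) / (p + 1)) := ⟨_, rfl⟩
  have hk0 : 0 ≤ k := hk ▸ rpow_nonneg hK0 _
  have hkp : k ^ (p + 1) = K := by
    rw [hk, ← rpow_mul hK0, one_div_mul_cancel (by positivity), rpow_one]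
  obtain ⟨γ, hγ⟩ : ∃ γ, γ = (p * q - 1) / (q + 1) := ⟨_, rfl⟩
  have hγ0 : 0 < γ := hγ ▸ div_pos (by linarith) (by linarith)
  obtain ⟨D, hD⟩ : ∃ D : ℝ, D = 2 ^ (p * q / (q + 1)) := ⟨_, rfl⟩
  have hD0 : 0 < D := hD ▸ rpow_pos_of_pos two_pos _
  have hA0 : 0 < c * (q + 1) * Cq ^ (1 / (q + 1)) / D := by positivity
  have hsum : ∀ t ∈ Ico 0 T, (c * g t) ^ (p + 1) + k ^ (p + 1) = Cq * f t ^ (q + 1) :=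
    fun t ht => by rw [hE t ht, mul_rpow hc0.le (hgnn t ht), hcp, hkp]
  have hpos : ∀ t ∈ Ico 0 T, 0 < c * g t + k := fun t ht => by
    have := hgpos t ht
    positivity
  have hineq : ∀ t ∈ Ico 0 T,
      c * (q + 1) * Cq ^ (1 / (q + 1)) / D * (c * g t + k) ^ (1 + γ) ≤
        c * ((q + 1) * Cq * f t ^ q) := fun t ht => by
    have hft := hfnn t ht
    have h1 := add_rpow_le_two_rpow_mul (mul_nonneg hc0.le (hgnn t ht)) hk0
      (by linarith : 1 ≤ p + 1)
    rw [hsum t ht, add_sub_cancel_right] at h1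
    have h2 := rpow_le_rpow (rpow_nonneg (hpos t ht).le _) h1
      (by positivity : 0 ≤ q / (q + 1))
    rw [← rpow_mul (hpos t ht).le, mul_rpow (by positivity) (by positivity),
      mul_rpow hCq.le (by positivity), ← rpow_mul two_pos.le, ← rpow_mul hft,
      show (p + 1) * (q / (q + 1)) = 1 + γ by rw [hγ]; field_simp; ring,
      show p * (q / (q + 1)) = p * q / (q + 1) by ring, ← hD,
      show (q + 1) * (q / (q + 1)) = q by field_simp] at h2
    have hCqq : Cq ^ (1 / (q + 1)) * Cq ^ (q / (q + 1)) = Cq := by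
      rw [← rpow_add hCq, show 1 / (q + 1) + q / (q + 1) = 1 by field_simp; ring, rpow_one]
    calc _ ≤ c * (q + 1) * Cq ^ (1 / (q + 1)) / D * (D * (Cq ^ (q / (q + 1)) * f t ^ q)) :=
          mul_le_mul_of_nonneg_left h2 hA0.le
      _ = c * ((q + 1) * (Cq ^ (1 / (q + 1)) * Cq ^ (q / (q + 1))) * f t ^ q) := by
          field_simp
      _ = _ := by rw [hCqq]
  have hlife := le_of_rpow_le_deriv hT hA0 hγ0 hpos
    (fun t ht => ((hg' t ht).const_mul c).add_const k) hineq
  have hinit_le : (Cq * f₀ ^ (q + 1)) ^ (1 / (p + 1)) ≤ c * g 0 + k := by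
    have := rpow_add_rpow_le_add (mul_nonneg hc0.le (hgnn 0 h0)) hk0
      (by linarith : 1 ≤ p + 1)
    rwa [hsum 0 h0, hf0] at this
  have hanti := rpow_le_rpow_of_nonpos (by positivity) hinit_le (by linarith : -γ ≤ 0)
  refine hlife.trans ((div_le_div_of_nonneg_right hanti (by positivity)).trans_eq ?_)
  have hexp : ((Cq * f₀ ^ (q + 1)) ^ (1 / (p + 1))) ^ (-γ) =
      Cq ^ (-(p / (p + 1))) * Cq ^ (1 / (q + 1)) * f₀ ^ (-((p * q - 1) / (p + 1))) := by
    rw [← rpow_mul (by positivity), mul_rpow hCq.le (by positivity), ← rpow_mul hf₀.le,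
      ← rpow_add hCq]
    congr 2 <;> rw [hγ] <;> field_simp <;> ring
  have hγq : γ * (q + 1) = p * q - 1 := by rw [hγ]; field_simp
  have hCq1 : 0 < Cq ^ (1 / (q + 1)) := by positivity
  rw [hexp, ← hD, rpow_neg hCp.le, ← hc, ← hγq]
  field_simp
end

section
/- Let f₀, g₀, ω > 0, p, q > 0 with pq > 1, C_p, C_q > 0, and let (f, g) be non-negative C¹ solutions on the maximal interval [0, T) of f' + (ω/(q+1)) f = (p+1) C_p g^p, g' + (ω/(p+1)) g = (q+1) C_q f^q with f(0) = f₀, g(0) = g₀. If f₀ > max( 2^{((p+1)/(q+1))·(pq/(pq-1))} (q+1)^{-(p+1)/(pq-1)} (p+1)^{-(p+1)/(pq-1)} ω^{(p+1)/(pq-1)} C_p^{-1/(pq-1)} C_q^{-p/(pq-1)}, C_q^{-1/(q+1)} C_p^{1/(q+1)} g₀^{(p+1)/(q+1)} ), then T ≤ -((q+1)(p+1)/(ω(pq-1))) · log( 1 - (2^{pq/(q+1)}/((q+1)(p+1))) ω C_q^{-p/(p+1)} C_p^{-1/(p+1)} f₀^{-(pq-1)/(p+1)} ). -/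
open Real Set

/-- Along a system `u' = e a v ^ p`, `v' = e b u ^ q` of Hamiltonian type, the energy
`Cq u ^ (q + 1) - Cp v ^ (p + 1)` is conserved. -/
lemma energy_conserved {p q Cp Cq T : ℝ} (hp : 0 < p) (hq : 0 < q) {u v e : ℝ → ℝ}
    (hu : ∀ t ∈ Ico (0 : ℝ) T, HasDerivAt u (e t * ((p + 1) * Cp * v t ^ p)) t)
    (hv : ∀ t ∈ Ico (0 : ℝ) T, HasDerivAt v (e t * ((q + 1) * Cq * u t ^ q)) t)
    {t : ℝ} (ht : t ∈ Ico (0 : ℝ) T) :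
    Cq * u t ^ (q + 1) - Cp * v t ^ (p + 1) = Cq * u 0 ^ (q + 1) - Cp * v 0 ^ (p + 1) := by
  have hd : ∀ s ∈ Ico (0 : ℝ) T,
      HasDerivAt (fun x => Cq * u x ^ (q + 1) - Cp * v x ^ (p + 1)) 0 s := by
    intro s hs
    have h1 := ((hu s hs).rpow_const (p := q + 1) (Or.inr (by linarith))).const_mul Cq
    have h2 := ((hv s hs).rpow_const (p := p + 1) (Or.inr (by linarith))).const_mul Cp
    refine (h1.sub h2).congr_deriv ?_
    rw [add_sub_cancel_right, add_sub_cancel_right]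
    ring
  refine constant_of_has_deriv_right_zero (a := 0) (b := t)
    (f := fun x => Cq * u x ^ (q + 1) - Cp * v x ^ (p + 1)) ?_ ?_ t ⟨ht.1, le_rfl⟩
  · intro x hx
    exact (hd x ⟨hx.1, hx.2.trans_lt ht.2⟩).continuousAt.continuousWithinAt
  · intro x hx
    exact (hd x ⟨hx.1, hx.2.trans ht.2⟩).hasDerivWithinAt

/-- A positive function with `w' ≥ A e ^ (-μ t) w ^ (1 + α)` can exist only as long as the
rescaled time `(1 - e ^ (-μ t)) / μ` is at most `w(0) ^ (-α) / (α A)`. -/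
lemma rescaled_time_le_of_superlinear_growth {A α μ T : ℝ} (hα : 0 < α) (hμ : 0 < μ)
    {w w' : ℝ → ℝ} (hw : ∀ t ∈ Ico (0 : ℝ) T, HasDerivAt w (w' t) t)
    (hpos : ∀ t ∈ Ico (0 : ℝ) T, 0 < w t)
    (hgrowth : ∀ t ∈ Ico (0 : ℝ) T, A * exp (-μ * t) * w t ^ (α + 1) ≤ w' t)
    {t : ℝ} (ht : t ∈ Ico (0 : ℝ) T) :
    α * A * (1 - exp (-μ * t)) / μ ≤ w 0 ^ (-α) := by
  let W : ℝ → ℝ := fun x => w x ^ (-α) + α * A * (1 - exp (-μ * x)) / μ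
  have hd : ∀ s ∈ Ico (0 : ℝ) T,
      HasDerivAt W (w' s * (-α) * w s ^ (-α - 1) + α * A * exp (-μ * s)) s := by
    intro s hs
    have h1 := (hw s hs).rpow_const (p := -α) (Or.inl (hpos s hs).ne')
    have h2 : HasDerivAt (fun x : ℝ => -μ * x) (-μ) s := by
      simpa using (hasDerivAt_id s).const_mul (-μ)
    have h3 := ((h2.exp.const_sub 1).const_mul (α * A)).div_const μ
    refine (h1.add h3).congr_deriv ?_
    field_simp
  have hanti : AntitoneOn W (Ico 0 T) := by
    refine antitoneOn_of_deriv_nonpos (convex_Ico 0 T)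
      (fun x hx => (hd x hx).continuousAt.continuousWithinAt)
      (fun x hx => (hd x (interior_subset hx)).differentiableAt.differentiableWithinAt) ?_
    intro s hs
    have hs := interior_subset hs
    rw [(hd s hs).deriv]
    have hws := hpos s hs
    have hcancel : w s ^ (α + 1) * w s ^ (-α - 1) = 1 := by
      rw [← rpow_add hws, show α + 1 + (-α - 1) = 0 by ring, rpow_zero]
    have h4 := mul_le_mul_of_nonneg_right (hgrowth s hs) (rpow_nonneg hws.le (-α - 1))
    rw [mul_assoc, hcancel, mul_one] at h4
    nlinarith [mul_le_mul_of_nonneg_left h4 hα.le]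
  have h0 := hanti ⟨le_rfl, ht.1.trans_lt ht.2⟩ ht ht.1
  have h5 := rpow_nonneg (hpos t ht).le (-α)
  simp only [W, mul_zero, exp_zero, sub_self, zero_div, add_zero] at h0
  linarith

/-- If `Cq u ^ (q + 1) = Cp v ^ (p + 1) + Cp k ^ (p + 1)` then `u ^ q` dominates a power of
`v + k`. -/
lemma rpow_lower_bound_of_energy {p q Cp Cq u v k : ℝ} (hp : 0 < p) (hq : 0 < q)
    (hCp : 0 < Cp) (hCq : 0 < Cq) (hu : 0 ≤ u) (hv : 0 ≤ v) (hk : 0 ≤ k)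
    (h : Cq * u ^ (q + 1) = Cp * v ^ (p + 1) + Cp * k ^ (p + 1)) :
    (Cp / Cq * 2 ^ (-p)) ^ (q / (q + 1)) * (v + k) ^ ((p * q - 1) / (q + 1) + 1) ≤ u ^ q := by
  have h1 : (v + k) ^ (p + 1) ≤ 2 ^ p * (v ^ (p + 1) + k ^ (p + 1)) := by
    have h := NNReal.rpow_add_le_mul_rpow_add_rpow ⟨v, hv⟩ ⟨k, hk⟩
      (show 1 ≤ p + 1 by linarith)
    rw [add_sub_cancel_right] at h
    exact_mod_cast h
  have h2 : u ^ (q + 1) = Cp / Cq * (v ^ (p + 1) + k ^ (p + 1)) := by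
    field_simp
    linarith
  have h3 : Cp / Cq * 2 ^ (-p) * (v + k) ^ (p + 1) ≤ u ^ (q + 1) := by
    rw [h2, mul_assoc]
    gcongr
    rw [rpow_neg zero_le_two, inv_mul_le_iff₀ (by positivity)]
    exact h1
  have h4 := rpow_le_rpow (by positivity) h3 (show 0 ≤ q / (q + 1) by positivity)
  rw [mul_rpow (by positivity) (by positivity), ← rpow_mul (by positivity),
    ← rpow_mul hu] at h4
  convert h4 using 3 <;> field_simp
  ring

/-- The smallness condition making the argument of the logarithm in the lifespan bound positive. -/
lemma lifespan_log_arg_pos {f₀ ω Cp Cq p q : ℝ} (hf₀ : 0 < f₀) (hω : 0 < ω)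
    (hCp : 0 < Cp) (hCq : 0 < Cq) (hp : 0 < p) (hq : 0 < q) (hpq : 1 < p * q)
    (h : 2 ^ ((p + 1) / (q + 1) * (p * q / (p * q - 1))) * (q + 1) ^ (-((p + 1) / (p * q - 1))) *
        (p + 1) ^ (-((p + 1) / (p * q - 1))) * ω ^ ((p + 1) / (p * q - 1)) *
        Cp ^ (-((1 : ℝ) / (p * q - 1))) * Cq ^ (-(p / (p * q - 1))) < f₀) :
    2 ^ (p * q / (q + 1)) / ((q + 1) * (p + 1)) * ω *
        Cq ^ (-(p / (p + 1))) * Cp ^ (-((1 : ℝ) / (p + 1))) *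
        f₀ ^ (-((p * q - 1) / (p + 1))) < 1 := by
  have hd : 0 < p * q - 1 := by linarith
  have hp1 : 0 < p + 1 := by linarith
  have hq1 : 0 < q + 1 := by linarith
  have hlog := Real.log_lt_log (by positivity) h
  rw [← Real.log_neg_iff (by positivity)]
  rw [log_mul (by positivity) (by positivity), log_mul (by positivity) (by positivity),
    log_mul (by positivity) (by positivity), log_mul (by positivity) (by positivity),
    log_mul (by positivity) (by positivity), log_rpow two_pos, log_rpow hq1, log_rpow hp1,
    log_rpow hω, log_rpow hCp, log_rpow hCq] at hlog
  rw [log_mul (by positivity) (by positivity), log_mul (by positivity) (by positivity),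
    log_mul (by positivity) (by positivity), log_mul (by positivity) (by positivity),
    log_div (by positivity) (by positivity), log_mul (by positivity) (by positivity),
    log_rpow two_pos, log_rpow hCp, log_rpow hCq, log_rpow hf₀]
  have h6 := mul_lt_mul_of_pos_left hlog (show 0 < (p * q - 1) / (p + 1) by positivity)
  rw [← sub_pos] at h6 ⊢
  refine h6.trans_eq ?_
  field_simp
  ring

/-- Identity between the constant of the rescaled ODE inequality and the one in the lifespan
bound. -/
lemma lifespan_constant_eq {f₀ ω Cp Cq p q : ℝ} (hf₀ : 0 < f₀) (hω : 0 < ω)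
    (hCp : 0 < Cp) (hCq : 0 < Cq) (hp : 0 < p) (hq : 0 < q) :
    2 ^ (p * q / (q + 1)) / ((q + 1) * (p + 1)) * ω *
        Cq ^ (-(p / (p + 1))) * Cp ^ (-((1 : ℝ) / (p + 1))) * f₀ ^ (-((p * q - 1) / (p + 1))) *
      ((p + 1) * ((q + 1) * Cq * (Cp / Cq * 2 ^ (-p)) ^ (q / (q + 1)))) =
    ω * (Cq / Cp * f₀ ^ (q + 1)) ^ (-((p * q - 1) / ((p + 1) * (q + 1)))) := by
  have hp1 : 0 < p + 1 := by linarith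
  have hq1 : 0 < q + 1 := by linarith
  apply Real.log_injOn_pos (mem_Ioi.2 (by positivity)) (mem_Ioi.2 (by positivity))
  rw [log_mul (by positivity) (by positivity), log_mul (by positivity) (by positivity),
    log_mul (by positivity) (by positivity), log_mul (by positivity) (by positivity),
    log_mul (by positivity) (by positivity), log_div (by positivity) (by positivity),
    log_mul (x := q + 1) (by positivity) (by positivity),
    log_mul (x := p + 1) (by positivity) (by positivity),
    log_mul (x := (q + 1) * Cq) (by positivity) (by positivity),
    log_mul (x := q + 1) (by positivity) (by positivity),
    log_mul (x := ω) (by positivity) (by positivity),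
    log_rpow two_pos, log_rpow hCp, log_rpow hCq, log_rpow hf₀,
    log_rpow (x := Cp / Cq * 2 ^ (-p)) (by positivity),
    log_rpow (x := Cq / Cp * f₀ ^ (q + 1)) (by positivity),
    log_mul (x := Cp / Cq) (by positivity) (by positivity),
    log_mul (x := Cq / Cp) (by positivity) (by positivity),
    log_div hCp.ne' hCq.ne', log_div hCq.ne' hCp.ne', log_rpow two_pos, log_rpow hf₀]
  field_simp
  ring

/-- Removing the damping: if `f' = F - a f`, then `e ^ (a t) f` has derivative `e ^ (a t) F`. -/
lemma hasDerivAt_exp_mul_of_damped {f : ℝ → ℝ} {F a t : ℝ} (hf : HasDerivAt f (F - a * f t) t) :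
    HasDerivAt (fun x => exp (a * x) * f x) (exp (a * t) * F) t := by
  have h : HasDerivAt (fun x : ℝ => a * x) a t := by
    simpa using (hasDerivAt_id t).const_mul a
  refine (h.exp.mul hf).congr_deriv ?_
  ring

/-- Rescaling the source term: if `a = p b - μ`, then the powers of the unknown can be written in
terms of the undamped unknown. -/
lemma exp_mul_rpow_eq {a b p μ t x : ℝ} (hx : 0 ≤ x) (hab : a = p * b - μ) :
    exp (a * t) * x ^ p = exp (-μ * t) * (exp (b * t) * x) ^ p := by
  rw [mul_rpow (exp_pos _).le hx, ← exp_mul, ← mul_assoc, ← exp_add, hab]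
  ring_nf

theorem stmt_9 (f₀ g₀ ω Cp Cq T p q : ℝ)
    (hf₀ : 0 < f₀) (hg₀ : 0 < g₀) (hω : 0 < ω)
    (hCp : 0 < Cp) (hCq : 0 < Cq) (hT : 0 < T)
    (hp : 0 < p) (hq : 0 < q) (hpq : 1 < p * q)
    (f g : ℝ → ℝ)
    (hfnn : ∀ t ∈ Set.Ico (0 : ℝ) T, 0 ≤ f t) (hgnn : ∀ t ∈ Set.Ico (0 : ℝ) T, 0 ≤ g t)
    (hf' : ∀ t ∈ Set.Ico (0 : ℝ) T,
      HasDerivAt f ((p + 1) * Cp * g t ^ p - ω / (q + 1) * f t) t)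
    (hg' : ∀ t ∈ Set.Ico (0 : ℝ) T,
      HasDerivAt g ((q + 1) * Cq * f t ^ q - ω / (p + 1) * g t) t)
    (hf0 : f 0 = f₀) (hg0 : g 0 = g₀)
    (hmax : ¬ ∃ (T' : ℝ) (F G : ℝ → ℝ), T < T' ∧
      (∀ t ∈ Set.Ico (0 : ℝ) T, F t = f t ∧ G t = g t) ∧
      (∀ t ∈ Set.Ico (0 : ℝ) T', 0 ≤ F t ∧ 0 ≤ G t) ∧
      (∀ t ∈ Set.Ico (0 : ℝ) T',
        HasDerivAt F ((p + 1) * Cp * G t ^ p - ω / (q + 1) * F t) t ∧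
        HasDerivAt G ((q + 1) * Cq * F t ^ q - ω / (p + 1) * G t) t))
    (hinit : max
      (2 ^ ((p + 1) / (q + 1) * (p * q / (p * q - 1))) * (q + 1) ^ (-((p + 1) / (p * q - 1))) *
        (p + 1) ^ (-((p + 1) / (p * q - 1))) * ω ^ ((p + 1) / (p * q - 1)) *
        Cp ^ (-((1 : ℝ) / (p * q - 1))) * Cq ^ (-(p / (p * q - 1))))
      (Cq ^ (-((1 : ℝ) / (q + 1))) * Cp ^ ((1 : ℝ) / (q + 1)) * g₀ ^ ((p + 1) / (q + 1)))
      < f₀) :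
    T ≤ -((q + 1) * (p + 1) / (ω * (p * q - 1))) *
      Real.log (1 - 2 ^ (p * q / (q + 1)) / ((q + 1) * (p + 1)) * ω *
        Cq ^ (-(p / (p + 1))) * Cp ^ (-((1 : ℝ) / (p + 1))) * f₀ ^ (-((p * q - 1) / (p + 1)))) := by
  have hp1 : 0 < p + 1 := by linarith
  have hq1 : 0 < q + 1 := by linarith
  have hd : 0 < p * q - 1 := by linarith
  obtain ⟨hinit1, hinit2⟩ := max_lt_iff.1 hinit
  have hX := lifespan_log_arg_pos hf₀ hω hCp hCq hp hq hpq hinit1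
  have hconst := lifespan_constant_eq hf₀ hω hCp hCq hp hq
  set X := 2 ^ (p * q / (q + 1)) / ((q + 1) * (p + 1)) * ω *
        Cq ^ (-(p / (p + 1))) * Cp ^ (-((1 : ℝ) / (p + 1))) * f₀ ^ (-((p * q - 1) / (p + 1)))
  set D := (Cp / Cq * 2 ^ (-p)) ^ (q / (q + 1)) with hD
  have hDpos : 0 < D := by positivity
  have hK : 0 < Cq / Cp * f₀ ^ (q + 1) - g₀ ^ (p + 1) := by
    have h := rpow_lt_rpow (by positivity) hinit2 hq1
    rw [mul_rpow (by positivity) (by positivity), mul_rpow (by positivity) (by positivity),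
      ← rpow_mul hCq.le, ← rpow_mul hCp.le, ← rpow_mul hg₀.le, neg_mul,
      div_mul_cancel₀ _ hq1.ne', div_mul_cancel₀ _ hq1.ne', rpow_neg_one, rpow_one] at h
    rw [sub_pos, div_mul_eq_mul_div, lt_div_iff₀ hCp]
    rw [mul_assoc, inv_mul_lt_iff₀ hCq] at h
    linarith
  obtain ⟨k, hk, hkp⟩ : ∃ k : ℝ, 0 < k ∧
      k ^ (p + 1) = Cq / Cp * f₀ ^ (q + 1) - g₀ ^ (p + 1) :=
    ⟨_, rpow_pos_of_pos hK (p + 1)⁻¹, rpow_inv_rpow hK.le hp1.ne'⟩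
  set μ := ω * ((p * q - 1) / ((p + 1) * (q + 1))) with hμ
  have hμpos : 0 < μ := by positivity
  let u : ℝ → ℝ := fun t => exp (ω / (q + 1) * t) * f t
  let v : ℝ → ℝ := fun t => exp (ω / (p + 1) * t) * g t
  have hu : ∀ t ∈ Ico (0 : ℝ) T, HasDerivAt u (exp (-μ * t) * ((p + 1) * Cp * v t ^ p)) t := by
    intro t ht
    refine (hasDerivAt_exp_mul_of_damped (hf' t ht)).congr_deriv ?_
    have h := exp_mul_rpow_eq (a := ω / (q + 1)) (b := ω / (p + 1)) (p := p) (μ := μ) (t := t)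
      (hgnn t ht) (by rw [hμ]; field_simp; ring)
    linear_combination (p + 1) * Cp * h
  have hv : ∀ t ∈ Ico (0 : ℝ) T, HasDerivAt v (exp (-μ * t) * ((q + 1) * Cq * u t ^ q)) t := by
    intro t ht
    refine (hasDerivAt_exp_mul_of_damped (hg' t ht)).congr_deriv ?_
    have h := exp_mul_rpow_eq (a := ω / (p + 1)) (b := ω / (q + 1)) (p := q) (μ := μ) (t := t)
      (hfnn t ht) (by rw [hμ]; field_simp; ring)
    linear_combination (q + 1) * Cq * h
  have hunn : ∀ t ∈ Ico (0 : ℝ) T, 0 ≤ u t := fun t ht => mul_nonneg (exp_pos _).le (hfnn t ht)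
  have hvnn : ∀ t ∈ Ico (0 : ℝ) T, 0 ≤ v t := fun t ht => mul_nonneg (exp_pos _).le (hgnn t ht)
  have hu0 : u 0 = f₀ := by simp [u, hf0]
  have hv0 : v 0 = g₀ := by simp [v, hg0]
  have hgrowth : ∀ t ∈ Ico (0 : ℝ) T,
      (q + 1) * Cq * D * exp (-μ * t) * (v t + k) ^ ((p * q - 1) / (q + 1) + 1) ≤
        exp (-μ * t) * ((q + 1) * Cq * u t ^ q) := by
    intro t ht
    have hE := energy_conserved hp hq hu hv ht
    rw [hu0, hv0] at hE
    have hb := rpow_lower_bound_of_energy hp hq hCp hCq (hunn t ht) (hvnn t ht) hk.le (by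
      rw [hkp]
      field_simp
      linarith)
    have h := mul_le_mul_of_nonneg_left hb
      (show 0 ≤ exp (-μ * t) * ((q + 1) * Cq) by positivity)
    rw [← hD] at h
    linarith
  have hw0 : (v 0 + k) ^ (-((p * q - 1) / (q + 1))) ≤
      (Cq / Cp * f₀ ^ (q + 1)) ^ (-((p * q - 1) / ((p + 1) * (q + 1)))) := by
    have h1 := Real.add_rpow_le_rpow_add hg₀.le hk.le (show 1 ≤ p + 1 by linarith)
    rw [hkp, add_sub_cancel] at h1
    have h2 := rpow_le_rpow_of_nonpos (by positivity) h1
      (show -((p * q - 1) / ((p + 1) * (q + 1))) ≤ 0 by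
        rw [neg_nonpos]; positivity)
    rw [← rpow_mul (by positivity)] at h2
    rw [hv0]
    convert h2 using 2
    field_simp
  have hkey : ∀ t ∈ Ico (0 : ℝ) T,
      t ≤ -((q + 1) * (p + 1) / (ω * (p * q - 1))) * Real.log (1 - X) := by
    intro t ht
    have h1 := (rescaled_time_le_of_superlinear_growth (A := (q + 1) * Cq * D)
      (α := (p * q - 1) / (q + 1)) (by positivity) hμpos (w := fun t => v t + k)
      (fun s hs => (hv s hs).add_const k) (fun s hs => add_pos_of_nonneg_of_pos (hvnn s hs) hk)
      hgrowth ht).trans hw0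
    have h2 : (p + 1) * ((q + 1) * Cq * D) * (1 - exp (-μ * t)) ≤
        (p + 1) * ((q + 1) * Cq * D) * X := by
      have h3 := mul_le_mul_of_nonneg_left h1 hω.le
      rw [← hconst] at h3
      have h4 : ω * ((p * q - 1) / (q + 1) * ((q + 1) * Cq * D) * (1 - exp (-μ * t)) / μ) =
          (p + 1) * ((q + 1) * Cq * D) * (1 - exp (-μ * t)) := by
        generalize exp (-μ * t) = E
        rw [hμ]
        field_simp
      linarith
    have h5 := le_of_mul_le_mul_left h2 (by positivity)
    have h6 : Real.log (1 - X) ≤ -μ * t := by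
      rw [Real.log_le_iff_le_exp (by linarith)]
      linarith
    have h7 : (q + 1) * (p + 1) / (ω * (p * q - 1)) = μ⁻¹ := by
      rw [hμ]
      field_simp
    rw [h7, neg_mul, ← mul_neg, le_inv_mul_iff₀ hμpos]
    linarith
  exact le_of_forall_lt_imp_le_of_dense fun t ht =>
    (le_max_left t 0).trans (hkey _ ⟨le_max_right _ _, max_lt ht hT⟩)
end
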